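/- Let A be an m×n real matrix with s-restricted isometry constant δ_s(A), and let Q be an m×q basis matrix (QᵀQ = I_q). Define κ_{s,A}(Q) := max over T ⊆ {1,…,n} with |T| ≤ s of ‖A_Tᵀ Q‖₂. Then for every index set T ⊆ {1,…,n} with |T| ≤ s and every x ∈ ℝ^{|T|}, (1 − κ_{s,A}(Q)² − δ_s(A))‖x‖₂² ≤ ‖(I − QQᵀ) A_T x‖₂² ≤ (1 + δ_s(A))‖x‖₂². Consequently, the s-restricted isometry constant of the matrix (I − QQᵀ)A satisfies δ_s((I − QQᵀ)A) ≤ κ_{s,A}(Q)² + δ_s(A). -/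

import Mathlib

open Matrix

noncomputable def vecNorm {ι : Type*} [Fintype ι] (v : ι → ℝ) : ℝ :=
  Real.sqrt (∑ i, v i ^ 2)

noncomputable def specNorm {m n : Type*} [Fintype m] [Fintype n] [DecidableEq n]
    (A : Matrix m n ℝ) : ℝ :=
  ‖LinearMap.toContinuousLinearMap (Matrix.toEuclideanLin A)‖

noncomputable def kappa {n r : ℕ} (s : ℕ) (P : Matrix (Fin n) (Fin r) ℝ) : ℝ :=
  ⨆ T : {T : Finset (Fin n) // T.card ≤ s},
    specNorm (P.submatrix (Subtype.val : {i // i ∈ T.1} → Fin n) id)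

noncomputable def RIC {m n : ℕ} (s : ℕ) (A : Matrix (Fin m) (Fin n) ℝ) : ℝ :=
  sInf {δ : ℝ | 0 ≤ δ ∧ ∀ T : Finset (Fin n), T.card ≤ s →
    ∀ x : {i // i ∈ T} → ℝ,
      (1 - δ) * vecNorm x ^ 2 ≤
        vecNorm ((A.submatrix id (Subtype.val : {i // i ∈ T} → Fin n)).mulVec x) ^ 2 ∧
      vecNorm ((A.submatrix id (Subtype.val : {i // i ∈ T} → Fin n)).mulVec x) ^ 2 ≤
        (1 + δ) * vecNorm x ^ 2}

noncomputable def kappaA {m n q : ℕ} (s : ℕ) (A : Matrix (Fin m) (Fin n) ℝ)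
    (Q : Matrix (Fin m) (Fin q) ℝ) : ℝ :=
  ⨆ T : {T : Finset (Fin n) // T.card ≤ s},
    specNorm ((A.submatrix id (Subtype.val : {i // i ∈ T.1} → Fin n))ᵀ * Q)

theorem vecNorm_nonneg {ι : Type*} [Fintype ι] (v : ι → ℝ) : 0 ≤ vecNorm v :=
  Real.sqrt_nonneg _

theorem vecNorm_eq_norm_toLp {ι : Type*} [Fintype ι] (v : ι → ℝ) :
    vecNorm v = ‖WithLp.toLp 2 v‖ := by
  simp [vecNorm, EuclideanSpace.norm_eq]

theorem vecNorm_sq {ι : Type*} [Fintype ι] (v : ι → ℝ) : vecNorm v ^ 2 = v ⬝ᵥ v := by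
  rw [vecNorm, Real.sq_sqrt (Finset.sum_nonneg fun i _ => sq_nonneg (v i))]
  simp [dotProduct, sq]

theorem specNorm_nonneg {m n : Type*} [Fintype m] [Fintype n] [DecidableEq n]
    (M : Matrix m n ℝ) : 0 ≤ specNorm M :=
  norm_nonneg _

theorem vecNorm_mulVec_le {m n : Type*} [Fintype m] [Fintype n] [DecidableEq n]
    (M : Matrix m n ℝ) (x : n → ℝ) : vecNorm (M *ᵥ x) ≤ specNorm M * vecNorm x := by
  rw [vecNorm_eq_norm_toLp, vecNorm_eq_norm_toLp]
  exact (LinearMap.toContinuousLinearMap (Matrix.toEuclideanLin M)).le_opNorm (WithLp.toLp 2 x)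

open scoped Matrix.Norms.L2Operator in
theorem specNorm_transpose {m n : Type*} [Fintype m] [Fintype n] [DecidableEq m] [DecidableEq n]
    (M : Matrix m n ℝ) : specNorm Mᵀ = specNorm M := by
  have h := Matrix.l2_opNorm_conjTranspose M
  rwa [Matrix.conjTranspose_eq_transpose_of_trivial, Matrix.l2_opNorm_def,
    Matrix.l2_opNorm_def] at h

theorem vecNorm_one_sub_mul_transpose_mulVec_sq {m q : Type*} [Fintype m] [Fintype q]
    [DecidableEq m] [DecidableEq q] {Q : Matrix m q ℝ} (hQ : Qᵀ * Q = 1) (u : m → ℝ) :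
    vecNorm ((1 - Q * Qᵀ) *ᵥ u) ^ 2 = vecNorm u ^ 2 - vecNorm (Qᵀ *ᵥ u) ^ 2 := by
  have hcross : u ⬝ᵥ (Q *ᵥ (Qᵀ *ᵥ u)) = (Qᵀ *ᵥ u) ⬝ᵥ (Qᵀ *ᵥ u) := by
    rw [Matrix.dotProduct_mulVec, ← Matrix.mulVec_transpose]
  have hproj : (Q *ᵥ (Qᵀ *ᵥ u)) ⬝ᵥ (Q *ᵥ (Qᵀ *ᵥ u)) = (Qᵀ *ᵥ u) ⬝ᵥ (Qᵀ *ᵥ u) := by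
    rw [Matrix.dotProduct_mulVec, ← Matrix.mulVec_transpose, Matrix.mulVec_mulVec _ Qᵀ Q, hQ,
      Matrix.one_mulVec]
  rw [vecNorm_sq, vecNorm_sq, vecNorm_sq, Matrix.sub_mulVec, Matrix.one_mulVec,
    ← Matrix.mulVec_mulVec, sub_dotProduct, dotProduct_sub, dotProduct_sub,
    dotProduct_comm (Q *ᵥ (Qᵀ *ᵥ u)) u, hproj, hcross]
  ring

theorem le_one_add_csInf_mul {S : Set ℝ} (hS : S.Nonempty) {v y : ℝ} (hv : 0 ≤ v)
    (h : ∀ δ ∈ S, y ≤ (1 + δ) * v) : y ≤ (1 + sInf S) * v := by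
  rcases hv.eq_or_lt with rfl | hv
  · obtain ⟨δ, hδ⟩ := hS
    simpa using h δ hδ
  · have : y / v - 1 ≤ sInf S := le_csInf hS fun δ hδ => by
      linarith [(div_le_iff₀ hv).2 (h δ hδ)]
    exact (div_le_iff₀ hv).1 (by linarith)

theorem RIC_nonneg {m n : ℕ} (s : ℕ) (A : Matrix (Fin m) (Fin n) ℝ) : 0 ≤ RIC s A :=
  Real.sInf_nonneg fun _ h => h.1

theorem RIC_spec {m n : ℕ} {s : ℕ} (A : Matrix (Fin m) (Fin n) ℝ) {T : Finset (Fin n)}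
    (hT : T.card ≤ s) (x : {i // i ∈ T} → ℝ) :
    (1 - RIC s A) * vecNorm x ^ 2 ≤
        vecNorm ((A.submatrix id (Subtype.val : {i // i ∈ T} → Fin n)) *ᵥ x) ^ 2 ∧
      vecNorm ((A.submatrix id (Subtype.val : {i // i ∈ T} → Fin n)) *ᵥ x) ^ 2 ≤
        (1 + RIC s A) * vecNorm x ^ 2 := by
  have hne : {δ : ℝ | 0 ≤ δ ∧ ∀ T : Finset (Fin n), T.card ≤ s → ∀ x : {i // i ∈ T} → ℝ,
      (1 - δ) * vecNorm x ^ 2 ≤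
        vecNorm ((A.submatrix id (Subtype.val : {i // i ∈ T} → Fin n)) *ᵥ x) ^ 2 ∧
      vecNorm ((A.submatrix id (Subtype.val : {i // i ∈ T} → Fin n)) *ᵥ x) ^ 2 ≤
        (1 + δ) * vecNorm x ^ 2}.Nonempty := by
    set c : Finset (Fin n) → ℝ := fun T =>
      specNorm (A.submatrix id (Subtype.val : {i // i ∈ T} → Fin n)) ^ 2
    have hc0 : ∀ T, 0 ≤ c T := fun T => sq_nonneg _
    have hsum : 0 ≤ ∑ T, c T := Finset.sum_nonneg fun T _ => hc0 T
    refine ⟨1 + ∑ T, c T, by linarith, fun T _ x => ⟨?_, ?_⟩⟩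
    · nlinarith [sq_nonneg (vecNorm x), mul_nonneg hsum (sq_nonneg (vecNorm x)),
        sq_nonneg (vecNorm ((A.submatrix id (Subtype.val : {i // i ∈ T} → Fin n)) *ᵥ x))]
    · have hle : c T ≤ ∑ T, c T := Finset.single_le_sum (fun T _ => hc0 T) (Finset.mem_univ T)
      calc _ ≤ (specNorm (A.submatrix id (Subtype.val : {i // i ∈ T} → Fin n)) *
              vecNorm x) ^ 2 := pow_le_pow_left₀ (vecNorm_nonneg _) (vecNorm_mulVec_le _ x) 2
        _ = c T * vecNorm x ^ 2 := mul_pow _ _ _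
        _ ≤ _ := mul_le_mul_of_nonneg_right (by linarith) (sq_nonneg _)
  constructor
  · have := le_one_add_csInf_mul hne (sq_nonneg (vecNorm x))
      (y := 2 * vecNorm x ^ 2 -
        vecNorm ((A.submatrix id (Subtype.val : {i // i ∈ T} → Fin n)) *ᵥ x) ^ 2)
      fun δ hδ => by linarith [(hδ.2 T hT x).1]
    change _ ≤ (1 + RIC s A) * _ at this
    linarith
  · exact le_one_add_csInf_mul hne (sq_nonneg _) fun δ hδ => (hδ.2 T hT x).2

theorem specNorm_le_kappaA {m n q : ℕ} {s : ℕ} (A : Matrix (Fin m) (Fin n) ℝ)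
    (Q : Matrix (Fin m) (Fin q) ℝ) {T : Finset (Fin n)} (hT : T.card ≤ s) :
    specNorm ((A.submatrix id (Subtype.val : {i // i ∈ T} → Fin n))ᵀ * Q) ≤ kappaA s A Q :=
  le_ciSup (f := fun T : {T : Finset (Fin n) // T.card ≤ s} =>
    specNorm ((A.submatrix id (Subtype.val : {i // i ∈ T.1} → Fin n))ᵀ * Q))
    (Set.finite_range _).bddAbove ⟨T, hT⟩

theorem vecNorm_transpose_mulVec_le {m n q : ℕ} {s : ℕ} (A : Matrix (Fin m) (Fin n) ℝ)
    (Q : Matrix (Fin m) (Fin q) ℝ) {T : Finset (Fin n)} (hT : T.card ≤ s)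
    (x : {i // i ∈ T} → ℝ) :
    vecNorm (Qᵀ *ᵥ (A.submatrix id (Subtype.val : {i // i ∈ T} → Fin n) *ᵥ x)) ≤
      kappaA s A Q * vecNorm x := by
  set B := A.submatrix id (Subtype.val : {i // i ∈ T} → Fin n)
  calc vecNorm (Qᵀ *ᵥ (B *ᵥ x)) = vecNorm ((Bᵀ * Q)ᵀ *ᵥ x) := by
        rw [Matrix.mulVec_mulVec, Matrix.transpose_mul, Matrix.transpose_transpose]
    _ ≤ specNorm (Bᵀ * Q)ᵀ * vecNorm x := vecNorm_mulVec_le _ x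
    _ = specNorm (Bᵀ * Q) * vecNorm x := by rw [specNorm_transpose]
    _ ≤ kappaA s A Q * vecNorm x :=
        mul_le_mul_of_nonneg_right (specNorm_le_kappaA A Q hT) (vecNorm_nonneg x)

/-- RIP inequalities for (I − QQᵀ)A and the bound
δ_s((I − QQᵀ)A) ≤ κ_{s,A}(Q)² + δ_s(A). -/
theorem stmt1 {m n q : ℕ} (s : ℕ) (A : Matrix (Fin m) (Fin n) ℝ)
    (Q : Matrix (Fin m) (Fin q) ℝ) (hQ : Qᵀ * Q = 1) :
    (∀ T : Finset (Fin n), T.card ≤ s → ∀ x : {i // i ∈ T} → ℝ,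
      (1 - kappaA s A Q ^ 2 - RIC s A) * vecNorm x ^ 2 ≤
        vecNorm ((((1 - Q * Qᵀ) * A).submatrix id
          (Subtype.val : {i // i ∈ T} → Fin n)).mulVec x) ^ 2 ∧
      vecNorm ((((1 - Q * Qᵀ) * A).submatrix id
          (Subtype.val : {i // i ∈ T} → Fin n)).mulVec x) ^ 2 ≤
        (1 + RIC s A) * vecNorm x ^ 2) ∧
    RIC s ((1 - Q * Qᵀ) * A) ≤ kappaA s A Q ^ 2 + RIC s A := by
  have hRIP : ∀ T : Finset (Fin n), T.card ≤ s → ∀ x : {i // i ∈ T} → ℝ,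
      (1 - kappaA s A Q ^ 2 - RIC s A) * vecNorm x ^ 2 ≤
        vecNorm ((((1 - Q * Qᵀ) * A).submatrix id
          (Subtype.val : {i // i ∈ T} → Fin n)).mulVec x) ^ 2 ∧
      vecNorm ((((1 - Q * Qᵀ) * A).submatrix id
          (Subtype.val : {i // i ∈ T} → Fin n)).mulVec x) ^ 2 ≤
        (1 + RIC s A) * vecNorm x ^ 2 := by
    intro T hT x
    have hmul : ((1 - Q * Qᵀ) * A).submatrix id (Subtype.val : {i // i ∈ T} → Fin n) =
        (1 - Q * Qᵀ) * A.submatrix id (Subtype.val : {i // i ∈ T} → Fin n) := rfl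
    rw [hmul, ← Matrix.mulVec_mulVec, vecNorm_one_sub_mul_transpose_mulVec_sq hQ]
    obtain ⟨hlow, hupp⟩ := RIC_spec A hT x
    have hκ := pow_le_pow_left₀ (vecNorm_nonneg _) (vecNorm_transpose_mulVec_le A Q hT x) 2
    rw [mul_pow] at hκ
    exact ⟨by linarith, (sub_le_self _ (sq_nonneg _)).trans hupp⟩
  refine ⟨hRIP, csInf_le ⟨0, fun _ h => h.1⟩
    ⟨add_nonneg (sq_nonneg _) (RIC_nonneg s A), fun T hT x => ?_⟩⟩
  obtain ⟨hlow, hupp⟩ := hRIP T hT x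
  exact ⟨by linarith, hupp.trans <| mul_le_mul_of_nonneg_right
    (by linarith [sq_nonneg (kappaA s A Q)]) (sq_nonneg _)⟩
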